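/- Converse of Theorem 3: let λ : ℝ → ℂ² be differentiable with |λ₁(s)|² + |λ₂(s)|² = 1 for all s, let ε₁, ε₂ : ℝ → ℝ, and set ζ₁(s) = a(λ(s)), ζ₂(s) = b(λ(s)), B(s) = c(λ(s)). If λ′(s) = (1/2)·(ε₁(s) + i·ε₂(s))·λ̂(s) for all s, then the type-2 Bishop equations hold: ζ₁′(s) = −ε₁(s)·B(s), ζ₂′(s) = −ε₂(s)·B(s) and B′(s) = ε₁(s)·ζ₁(s) + ε₂(s)·ζ₂(s) for all s. -/

import Mathlib

open Complex

noncomputable section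

/-- The mate (or conjugate) of a spinor `ψ = (ψ₁, ψ₂)` is `ψ̂ = (-conj ψ₂, conj ψ₁)`. -/
def mate (ψ : ℂ × ℂ) : ℂ × ℂ := (-(starRingEnd ℂ) ψ.2, (starRingEnd ℂ) ψ.1)

/-- The real vector `a(ψ) = (Re(ψ₁² - ψ₂²), -Im(ψ₁² + ψ₂²), -2 Re(ψ₁ψ₂))`. -/
def sa (ψ : ℂ × ℂ) : EuclideanSpace ℝ (Fin 3) :=
  WithLp.toLp 2 ![(ψ.1 ^ 2 - ψ.2 ^ 2).re, -(ψ.1 ^ 2 + ψ.2 ^ 2).im, -2 * (ψ.1 * ψ.2).re]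

/-- The real vector `b(ψ) = (Im(ψ₁² - ψ₂²), Re(ψ₁² + ψ₂²), -2 Im(ψ₁ψ₂))`. -/
def sb (ψ : ℂ × ℂ) : EuclideanSpace ℝ (Fin 3) :=
  WithLp.toLp 2 ![(ψ.1 ^ 2 - ψ.2 ^ 2).im, (ψ.1 ^ 2 + ψ.2 ^ 2).re, -2 * (ψ.1 * ψ.2).im]

/-- The real vector `c(ψ) = (2 Re(ψ₁ conj ψ₂), -2 Im(ψ₁ conj ψ₂), |ψ₁|² - |ψ₂|²)`. -/
def sc (ψ : ℂ × ℂ) : EuclideanSpace ℝ (Fin 3) :=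
  WithLp.toLp 2 ![2 * (ψ.1 * (starRingEnd ℂ) ψ.2).re, -2 * (ψ.1 * (starRingEnd ℂ) ψ.2).im,
    ‖ψ.1‖ ^ 2 - ‖ψ.2‖ ^ 2]

/-- Reinterpret a plain vector in `Fin 3 → ℝ` as an element of Euclidean 3-space. -/
def toE (v : Fin 3 → ℝ) : EuclideanSpace ℝ (Fin 3) := WithLp.toLp 2 v


theorem hasDerivAt_vec3 {f g h : ℝ → ℝ} {f' g' h' : ℝ} {s : ℝ} (hf : HasDerivAt f f' s)
    (hg : HasDerivAt g g' s) (hh : HasDerivAt h h' s) :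
    HasDerivAt (fun t => (WithLp.toLp 2 ![f t, g t, h t] : EuclideanSpace ℝ (Fin 3)))
      (WithLp.toLp 2 ![f', g', h']) s := by
  have h1 : HasDerivAt (fun t => ![f t, g t, h t]) ![f', g', h'] s := by
    rw [hasDerivAt_pi]
    intro i
    fin_cases i
    · exact hf
    · exact hg
    · exact hh
  exact ((PiLp.continuousLinearEquiv 2 ℝ (fun _ : Fin 3 => ℝ)).symm.toContinuousLinearMap.hasFDerivAt).comp_hasDerivAt s h1

theorem spinor_coords (lam : ℝ → ℂ × ℂ) (hlam : Differentiable ℝ lam)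
    (ε₁ ε₂ : ℝ → ℝ)
    (hspinor : ∀ s, deriv lam s
      = ((1 : ℂ) / 2 * ((ε₁ s : ℂ) + Complex.I * (ε₂ s : ℂ))) • mate (lam s)) (s : ℝ) :
    HasDerivAt (fun t => (lam t).1.re) (1 / 2 * (-ε₁ s * (lam s).2.re - ε₂ s * (lam s).2.im)) s ∧
    HasDerivAt (fun t => (lam t).1.im) (1 / 2 * (ε₁ s * (lam s).2.im - ε₂ s * (lam s).2.re)) s ∧
    HasDerivAt (fun t => (lam t).2.re) (1 / 2 * (ε₁ s * (lam s).1.re + ε₂ s * (lam s).1.im)) s ∧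
    HasDerivAt (fun t => (lam t).2.im) (1 / 2 * (-ε₁ s * (lam s).1.im + ε₂ s * (lam s).1.re)) s := by
  have h := (hlam s).hasDerivAt
  rw [hspinor s] at h
  have h1 := (ContinuousLinearMap.fst ℝ ℂ ℂ).hasFDerivAt.comp_hasDerivAt s h
  have h2 := (ContinuousLinearMap.snd ℝ ℂ ℂ).hasFDerivAt.comp_hasDerivAt s h
  have a1 := Complex.reCLM.hasFDerivAt.comp_hasDerivAt s h1
  have a2 := Complex.imCLM.hasFDerivAt.comp_hasDerivAt s h1
  have a3 := Complex.reCLM.hasFDerivAt.comp_hasDerivAt s h2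
  have a4 := Complex.imCLM.hasFDerivAt.comp_hasDerivAt s h2
  refine ⟨a1.congr_deriv ?_, a2.congr_deriv ?_, a3.congr_deriv ?_, a4.congr_deriv ?_⟩ <;>
    simp [mate] <;> ring

/-- Converse of Theorem 3: if a unit differentiable spinor field satisfies
`λ' = (1/2)(ε₁ + i ε₂) λ̂`, then the triad `ζ₁ = a(λ), ζ₂ = b(λ), B = c(λ)` satisfies
the type-2 Bishop equations with Bishop curvatures `ε₁, ε₂`. -/
theorem type2_bishop_of_spinor_equation (lam : ℝ → ℂ × ℂ) (hlam : Differentiable ℝ lam)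
    (hunit : ∀ s, ‖(lam s).1‖ ^ 2 + ‖(lam s).2‖ ^ 2 = 1)
    (ε₁ ε₂ : ℝ → ℝ)
    (hspinor : ∀ s, deriv lam s
      = ((1 : ℂ) / 2 * ((ε₁ s : ℂ) + Complex.I * (ε₂ s : ℂ))) • mate (lam s)) :
    (∀ s, deriv (fun t => sa (lam t)) s = (-ε₁ s) • sc (lam s)) ∧
    (∀ s, deriv (fun t => sb (lam t)) s = (-ε₂ s) • sc (lam s)) ∧
    (∀ s, deriv (fun t => sc (lam t)) s = ε₁ s • sa (lam s) + ε₂ s • sb (lam s)) := by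
  have key := spinor_coords lam hlam ε₁ ε₂ hspinor
  have hsa : ∀ ψ : ℂ × ℂ, sa ψ = WithLp.toLp 2 ![ψ.1.re * ψ.1.re - ψ.1.im * ψ.1.im
      - (ψ.2.re * ψ.2.re - ψ.2.im * ψ.2.im), -(2 * (ψ.1.re * ψ.1.im) + 2 * (ψ.2.re * ψ.2.im)),
      -2 * (ψ.1.re * ψ.2.re - ψ.1.im * ψ.2.im)] := by
    intro ψ
    ext i
    fin_cases i <;> simp [sa, pow_two] <;> ring
  have hsb : ∀ ψ : ℂ × ℂ, sb ψ = WithLp.toLp 2 ![2 * (ψ.1.re * ψ.1.im) - 2 * (ψ.2.re * ψ.2.im),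
      ψ.1.re * ψ.1.re - ψ.1.im * ψ.1.im + (ψ.2.re * ψ.2.re - ψ.2.im * ψ.2.im),
      -2 * (ψ.1.re * ψ.2.im + ψ.1.im * ψ.2.re)] := by
    intro ψ
    ext i
    fin_cases i <;> simp [sb, pow_two] <;> ring
  have hsc : ∀ ψ : ℂ × ℂ, sc ψ = WithLp.toLp 2 ![2 * (ψ.1.re * ψ.2.re + ψ.1.im * ψ.2.im),
      -2 * (ψ.1.im * ψ.2.re - ψ.1.re * ψ.2.im),
      ψ.1.re * ψ.1.re + ψ.1.im * ψ.1.im - (ψ.2.re * ψ.2.re + ψ.2.im * ψ.2.im)] := by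
    intro ψ
    ext i
    fin_cases i <;> simp [sc, Complex.sq_norm, Complex.normSq_apply] <;> ring
  simp only [hsa, hsb, hsc]
  refine ⟨fun s => ?_, fun s => ?_, fun s => ?_⟩ <;> obtain ⟨p, q, u, v⟩ := key s
  · refine (hasDerivAt_vec3 (((p.mul p).sub (q.mul q)).sub ((u.mul u).sub (v.mul v)))
      (((p.mul q).const_mul 2).add ((u.mul v).const_mul 2)).neg
      (((p.mul u).sub (q.mul v)).const_mul (-2))).deriv.trans ?_
    ext i
    fin_cases i <;> simp <;> ring
  · refine (hasDerivAt_vec3 (((p.mul q).const_mul 2).sub ((u.mul v).const_mul 2))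
      (((p.mul p).sub (q.mul q)).add ((u.mul u).sub (v.mul v)))
      (((p.mul v).add (q.mul u)).const_mul (-2))).deriv.trans ?_
    ext i
    fin_cases i <;> simp <;> ring
  · refine (hasDerivAt_vec3 (((p.mul u).add (q.mul v)).const_mul 2)
      (((q.mul u).sub (p.mul v)).const_mul (-2))
      (((p.mul p).add (q.mul q)).sub ((u.mul u).add (v.mul v)))).deriv.trans ?_
    ext i
    fin_cases i <;> simp <;> ring
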